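/- arXiv:2401.03450 — 3 statements merged into one kernel-verified Lean document; each statement's English description precedes it below -/
import Mathlib

section
/- Let (P₁,…,Pₙ,X) be a non-trivially critical configuration, and let 𝒫 be a subset of {P₁,…,Pₙ} containing at least two cameras. Then the configuration (𝒫, X) is a critical configuration. -/
open Matrix

noncomputable section

/-- `ℙ³ = ℙ(ℂ⁴)`. -/
abbrev P3 := Projectivization ℂ (Fin 4 → ℂ)

/-- Complexification of a real matrix. -/
def cx {m n : Type*} (A : Matrix m n ℝ) : Matrix m n ℂ :=
  A.map (fun a => (a : ℂ))

/-- `x ∈ ℙ³` is the camera center of the camera `P`. -/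
def IsCenter (P : Matrix (Fin 3) (Fin 4) ℝ) (x : P3) : Prop :=
  (cx P).mulVec x.rep = 0

/-- The points `x` and `y` of `ℙ³` have the same image in `ℙ²` under the cameras
`P` and `Q` respectively. -/
def SameImage (P Q : Matrix (Fin 3) (Fin 4) ℝ) (x y : P3) : Prop :=
  ∃ c : ℂ, c ≠ 0 ∧ (cx P).mulVec x.rep = c • (cx Q).mulVec y.rep

/-- `(P, X)` is a valid configuration: all cameras have rank 3, the camera centers are
pairwise distinct, and no point of `X` is a camera center. -/
def ValidConfig (n : ℕ) (P : Fin n → Matrix (Fin 3) (Fin 4) ℝ) (X : Set P3) : Prop :=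
  (∀ i, (P i).rank = 3) ∧
  (∀ i j : Fin n, i ≠ j → ∀ z : P3, IsCenter (P i) z → ¬ IsCenter (P j) z) ∧
  (∀ x ∈ X, ∀ i, ¬ IsCenter (P i) x)

/-- The configurations `(P, X)` and `(Q, Y)` are projectively equivalent via some
`H ∈ GL₄(ℝ)`: `H · X = Y` and `Pᵢ H⁻¹` is a nonzero real multiple of `Qᵢ` for all `i`. -/
def ProjEquiv (n : ℕ) (P Q : Fin n → Matrix (Fin 3) (Fin 4) ℝ) (X Y : Set P3) : Prop :=
  ∃ H : Matrix (Fin 4) (Fin 4) ℝ, IsUnit H ∧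
    (∀ x ∈ X, ∃ y ∈ Y, ∃ c : ℂ, c ≠ 0 ∧ (cx H).mulVec x.rep = c • y.rep) ∧
    (∀ y ∈ Y, ∃ x ∈ X, ∃ c : ℂ, c ≠ 0 ∧ (cx H).mulVec x.rep = c • y.rep) ∧
    (∀ i, ∃ l : ℝ, l ≠ 0 ∧ P i * H⁻¹ = l • Q i)

/-- `(Q, Y)` is a conjugate configuration of `(P, X)`: it is a valid configuration
producing the same images, and it is not projectively equivalent to `(P, X)`. -/
def IsConjugate (n : ℕ) (P : Fin n → Matrix (Fin 3) (Fin 4) ℝ) (X : Set P3)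
    (Q : Fin n → Matrix (Fin 3) (Fin 4) ℝ) (Y : Set P3) : Prop :=
  ValidConfig n Q Y ∧
  (∀ x ∈ X, ∃ y ∈ Y, ∀ i, SameImage (P i) (Q i) x y) ∧
  (∀ y ∈ Y, ∃ x ∈ X, ∀ i, SameImage (P i) (Q i) x y) ∧
  ¬ ProjEquiv n P Q X Y

/-- The configuration `(P, X)` is critical: it admits a conjugate configuration. -/
def IsCritical (n : ℕ) (P : Fin n → Matrix (Fin 3) (Fin 4) ℝ) (X : Set P3) : Prop :=
  ∃ Q Y, IsConjugate n P X Q Y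

/-- The 6×6 matrix whose first three rows are the blocks `(P₁ | x | 0)` and whose last
three rows are the blocks `(P₂ | 0 | y)`. -/
def bigM (P₁ P₂ : Matrix (Fin 3) (Fin 4) ℝ) (x y : Fin 3 → ℝ) :
    Matrix (Fin 6) (Fin 6) ℝ :=
  Matrix.of fun i j =>
    if hi : (i : ℕ) < 3 then
      if hj : (j : ℕ) < 4 then P₁ ⟨(i : ℕ), hi⟩ ⟨(j : ℕ), hj⟩
      else if (j : ℕ) = 4 then x ⟨(i : ℕ), hi⟩
      else 0
    else
      if hj : (j : ℕ) < 4 then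
        P₂ ⟨(i : ℕ) - 3, by have := i.isLt; omega⟩ ⟨(j : ℕ), hj⟩
      else if (j : ℕ) = 4 then 0
      else y ⟨(i : ℕ) - 3, by have := i.isLt; omega⟩

/-- `F` is the fundamental matrix of the ordered camera pair `(P₁, P₂)`:
`xᵀ F y = det M(x, y)` for all `x, y ∈ ℝ³`. -/
def IsFundamental (P₁ P₂ : Matrix (Fin 3) (Fin 4) ℝ)
    (F : Matrix (Fin 3) (Fin 3) ℝ) : Prop :=
  ∀ x y : Fin 3 → ℝ, x ⬝ᵥ F.mulVec y = (bigM P₁ P₂ x y).det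

/-- The configuration `(P, X)` is non-trivially critical: it admits a conjugate
configuration whose fundamental matrices are not real scalar multiples of those of `P`. -/
def IsNontrivCritical (n : ℕ) (P : Fin n → Matrix (Fin 3) (Fin 4) ℝ)
    (X : Set P3) : Prop :=
  ∃ Q Y, IsConjugate n P X Q Y ∧
    ∀ i j : Fin n, i < j →
      ∀ FP FQ : Matrix (Fin 3) (Fin 3) ℝ,
        IsFundamental (P i) (P j) FP → IsFundamental (Q i) (Q j) FQ →
        ∀ l : ℝ, FQ ≠ l • FP

theorem bigM_smul_mul (P₁ P₂ : Matrix (Fin 3) (Fin 4) ℝ) (K : Matrix (Fin 4) (Fin 4) ℝ)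
    (a b : ℝ) (x y : Fin 3 → ℝ) :
    bigM (a • (P₁ * K)) (b • (P₂ * K)) (a • x) (b • y) =
      Matrix.diagonal (fun i : Fin 6 => if (i : ℕ) < 3 then a else b) * bigM P₁ P₂ x y *
        Matrix.reindex finSumFinEquiv finSumFinEquiv
          (Matrix.fromBlocks K 0 0 1 : Matrix (Fin 4 ⊕ Fin 2) (Fin 4 ⊕ Fin 2) ℝ) := by
  let e : Fin 4 ⊕ Fin 2 ≃ Fin 6 := finSumFinEquiv
  have hl : ∀ k, (e (Sum.inl k) : ℕ) = k := fun _ => rfl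
  have hr : ∀ k, (e (Sum.inr k) : ℕ) = 4 + k := fun _ => rfl
  change _ = _ * Matrix.reindex e e _
  ext i j
  obtain ⟨j, rfl⟩ := e.surjective j
  rw [Matrix.mul_assoc, Matrix.diagonal_mul, Matrix.mul_apply, ← e.sum_comp,
    Fintype.sum_sum_type]
  rcases j with j | j
  · by_cases hi : (i : ℕ) < 3 <;> simp [bigM, hl, hr, hi, Matrix.mul_apply]
  · by_cases hi : (i : ℕ) < 3 <;> fin_cases j <;> simp [bigM, hr, hi]

theorem det_bigM_smul_mul (P₁ P₂ : Matrix (Fin 3) (Fin 4) ℝ) (K : Matrix (Fin 4) (Fin 4) ℝ)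
    (a b : ℝ) (x y : Fin 3 → ℝ) :
    (bigM (a • (P₁ * K)) (b • (P₂ * K)) (a • x) (b • y)).det =
      (a * b) ^ 3 * K.det * (bigM P₁ P₂ x y).det := by
  rw [bigM_smul_mul, Matrix.det_mul, Matrix.det_mul, Matrix.det_diagonal,
    Matrix.det_reindex_self, Matrix.det_fromBlocks_zero₂₁, Matrix.det_one]
  simp [Fin.prod_univ_succ]
  ring

theorem IsFundamental.smul_mul {P₁ P₂ : Matrix (Fin 3) (Fin 4) ℝ}
    {F : Matrix (Fin 3) (Fin 3) ℝ} (hF : IsFundamental P₁ P₂ F)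
    (K : Matrix (Fin 4) (Fin 4) ℝ) {a b : ℝ} (ha : a ≠ 0) (hb : b ≠ 0) :
    IsFundamental (a • (P₁ * K)) (b • (P₂ * K)) (((a * b) ^ 2 * K.det) • F) := by
  intro x y
  have h := det_bigM_smul_mul P₁ P₂ K a b (a⁻¹ • x) (b⁻¹ • y)
  rw [smul_inv_smul₀ ha, smul_inv_smul₀ hb, ← hF] at h
  rw [h]
  simp only [Matrix.smul_mulVec, Matrix.mulVec_smul, dotProduct_smul, smul_dotProduct,
    smul_eq_mul]
  field_simp

theorem bigM_eq_updateCol_left (P₁ P₂ : Matrix (Fin 3) (Fin 4) ℝ) (x y : Fin 3 → ℝ) :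
    bigM P₁ P₂ x y = (bigM P₁ P₂ 0 y).updateCol 4
      (fun i => if hi : (i : ℕ) < 3 then x ⟨i, hi⟩ else 0) := by
  ext i j
  fin_cases j <;> simp [bigM]

theorem bigM_eq_updateCol_right (P₁ P₂ : Matrix (Fin 3) (Fin 4) ℝ) (x y : Fin 3 → ℝ) :
    bigM P₁ P₂ x y = (bigM P₁ P₂ x 0).updateCol 5
      (fun i => if _ : (i : ℕ) < 3 then 0 else y ⟨(i : ℕ) - 3, by have := i.isLt; omega⟩) := by
  ext i j
  fin_cases j <;> simp [bigM]

theorem exists_isFundamental (P₁ P₂ : Matrix (Fin 3) (Fin 4) ℝ) :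
    ∃ F, IsFundamental P₁ P₂ F := by
  let B : (Fin 3 → ℝ) →ₗ[ℝ] (Fin 3 → ℝ) →ₗ[ℝ] ℝ :=
    LinearMap.mk₂ ℝ (fun x y => (bigM P₁ P₂ x y).det)
      (fun x x' y => by
        rw [bigM_eq_updateCol_left P₁ P₂ (x + x'), bigM_eq_updateCol_left P₁ P₂ x, bigM_eq_updateCol_left P₁ P₂ x']
        rw [← Matrix.det_updateCol_add]
        congr 2
        ext i
        by_cases hi : (i : ℕ) < 3 <;> simp [hi])
      (fun c x y => by
        rw [bigM_eq_updateCol_left P₁ P₂ (c • x), bigM_eq_updateCol_left P₁ P₂ x]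
        rw [smul_eq_mul, ← Matrix.det_updateCol_smul]
        congr 2
        ext i
        by_cases hi : (i : ℕ) < 3 <;> simp [hi])
      (fun x y y' => by
        rw [bigM_eq_updateCol_right P₁ P₂ x (y + y'), bigM_eq_updateCol_right P₁ P₂ x y,
          bigM_eq_updateCol_right P₁ P₂ x y']
        rw [← Matrix.det_updateCol_add]
        congr 2
        ext i
        by_cases hi : (i : ℕ) < 3 <;> simp [hi])
      (fun c x y => by
        rw [bigM_eq_updateCol_right P₁ P₂ x (c • y), bigM_eq_updateCol_right P₁ P₂ x y]
        rw [smul_eq_mul, ← Matrix.det_updateCol_smul]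
        congr 2
        ext i
        by_cases hi : (i : ℕ) < 3 <;> simp [hi])
  refine ⟨LinearMap.toMatrix₂' ℝ B, fun x y => ?_⟩
  rw [← Matrix.toLinearMap₂'_apply', Matrix.toLinearMap₂'_toMatrix']
  rfl

theorem ValidConfig.comp {n m : ℕ} {Q : Fin n → Matrix (Fin 3) (Fin 4) ℝ} {Y : Set P3}
    (h : ValidConfig n Q Y) {ι : Fin m → Fin n} (hι : Function.Injective ι) :
    ValidConfig m (fun k => Q (ι k)) Y :=
  ⟨fun k => h.1 (ι k), fun _ _ hkl => h.2.1 _ _ (hι.ne hkl), fun y hy k => h.2.2 y hy (ι k)⟩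

theorem statement9 (n m : ℕ) (hm : 2 ≤ m)
    (P : Fin n → Matrix (Fin 3) (Fin 4) ℝ) (X : Set P3)
    (hvalid : ValidConfig n P X)
    (hcrit : IsNontrivCritical n P X)
    (ι : Fin m → Fin n) (hι : Function.Injective ι) :
    IsCritical m (fun k => P (ι k)) X := by
  obtain ⟨Q, Y, ⟨hQ, hXY, hYX, -⟩, hF⟩ := hcrit
  refine ⟨fun k => Q (ι k), Y, hQ.comp hι, ?_, ?_, ?_⟩
  · intro x hx
    obtain ⟨y, hy, h⟩ := hXY x hx
    exact ⟨y, hy, fun k => h (ι k)⟩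
  · intro y hy
    obtain ⟨x, hx, h⟩ := hYX y hy
    exact ⟨x, hx, fun k => h (ι k)⟩
  · rintro ⟨H, -, -, -, hPQ⟩
    have key : ∀ k l : Fin m, ¬ ι k < ι l := by
      intro k l hkl
      obtain ⟨a, ha, hPa⟩ := hPQ k
      obtain ⟨b, hb, hPb⟩ := hPQ l
      obtain ⟨F, hFP⟩ := exists_isFundamental (P (ι k)) (P (ι l))
      have hFQ := hFP.smul_mul H⁻¹ (inv_ne_zero ha) (inv_ne_zero hb)
      rw [hPa, hPb, inv_smul_smul₀ ha, inv_smul_smul₀ hb] at hFQ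
      exact hF _ _ hkl _ _ hFP hFQ _ rfl
    have hne : ι ⟨0, by omega⟩ ≠ ι ⟨1, by omega⟩ := hι.ne (by simp)
    exact hne.lt_or_gt.elim (key _ _) (key _ _)
end
end

section
/- Let Q₁,Q₂,Q₃ be cameras whose camera centers q₁,q₂,q₃ (with representatives w₁,w₂,w₃ ∈ ℝ⁴) are pairwise distinct and do not lie on a common projective line, and let P₁,P₂,P₃ be cameras. Let x ∈ ℙ³ be a point that is not a camera center of any Pᵢ, with representative ξ ∈ ℂ⁴, and for each i let Lᵢ = {z ∈ ℂ⁴ : Qᵢz ∈ ℂ·(Pᵢξ)}, a two-dimensional linear subspace of ℂ⁴. Then dim(L₁ + L₂ + L₃) ≤ 3 if and only if for every i ∈ {1,2,3}, the vector Pᵢξ lies in the ℂ-linear span of Qᵢwⱼ and Qᵢw_k, where {i,j,k} = {1,2,3}. -/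
open Matrix

noncomputable section

/-- The complexification of a real vector. -/
def cxVec {n : Type*} (v : n → ℝ) : n → ℂ := fun k => (v k : ℂ)

lemma cx_mulVec_cxVec {m n : Type*} [Fintype n] (A : Matrix m n ℝ) (v : n → ℝ) :
    (cx A).mulVec (cxVec v) = cxVec (A.mulVec v) := by
  ext i
  simp [cx, cxVec, Matrix.mulVec, dotProduct]

lemma eq_cxVec_re_add_im {n : Type*} (z : n → ℂ) :
    z = cxVec (fun k => (z k).re) + Complex.I • cxVec (fun k => (z k).im) := by
  ext k
  simp [cxVec, mul_comm Complex.I, Complex.re_add_im]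

lemma cxVec_add_I_smul_eq_zero {n : Type*} {a b : n → ℝ}
    (h : cxVec a + Complex.I • cxVec b = 0) : a = 0 ∧ b = 0 := by
  refine ⟨funext fun k => ?_, funext fun k => ?_⟩
  · simpa [cxVec] using congrArg Complex.re (congrFun h k)
  · simpa [cxVec] using congrArg Complex.im (congrFun h k)

lemma cx_mulVec_surjective {m n : Type*} [Fintype n] {A : Matrix m n ℝ}
    (hA : Function.Surjective A.mulVec) : Function.Surjective (cx A).mulVec := by
  intro z
  obtain ⟨a, ha⟩ := hA fun k => (z k).re
  obtain ⟨b, hb⟩ := hA fun k => (z k).im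
  refine ⟨cxVec a + Complex.I • cxVec b, ?_⟩
  rw [Matrix.mulVec_add, Matrix.mulVec_smul, cx_mulVec_cxVec, cx_mulVec_cxVec, ha, hb]
  exact (eq_cxVec_re_add_im z).symm

lemma linearIndependent_cxVec {ι n : Type*} [Fintype ι] {w : ι → n → ℝ}
    (hw : LinearIndependent ℝ w) : LinearIndependent ℂ fun i => cxVec (w i) := by
  rw [Fintype.linearIndependent_iff] at hw ⊢
  intro g hg
  have key : cxVec (∑ i, (g i).re • w i) + Complex.I • cxVec (∑ i, (g i).im • w i) = 0 := by
    rw [← hg]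
    ext k
    simp only [cxVec, Pi.add_apply, Pi.smul_apply, Finset.sum_apply, smul_eq_mul,
      Complex.ofReal_sum, Complex.ofReal_mul, Finset.mul_sum, ← Finset.sum_add_distrib]
    refine Finset.sum_congr rfl fun i _ => ?_
    conv_rhs => rw [← Complex.re_add_im (g i)]
    ring
  obtain ⟨h₁, h₂⟩ := cxVec_add_I_smul_eq_zero key
  exact fun i => Complex.ext (hw _ h₁ i) (hw _ h₂ i)

lemma camera_mulVec_surjective {A : Matrix (Fin 3) (Fin 4) ℝ} (hA : A.rank = 3) :
    Function.Surjective A.mulVec := by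
  have : LinearMap.range A.mulVecLin = ⊤ :=
    Submodule.eq_top_of_finrank_eq (by simpa [Matrix.rank] using hA)
  exact LinearMap.range_eq_top.1 this

lemma exists_smul_eq_of_camera_mulVec_eq_zero {A : Matrix (Fin 3) (Fin 4) ℝ} (hA : A.rank = 3)
    {w : Fin 4 → ℝ} (hw : w ≠ 0) (hAw : A.mulVec w = 0) {v : Fin 4 → ℝ}
    (hv : A.mulVec v = 0) : ∃ c : ℝ, c • w = v := by
  have hker : Module.finrank ℝ (LinearMap.ker A.mulVecLin) = 1 := by
    have h := LinearMap.finrank_range_add_finrank_ker A.mulVecLin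
    rw [Module.finrank_fin_fun] at h
    change A.rank + _ = 4 at h
    omega
  obtain ⟨c, hc⟩ := exists_smul_eq_of_finrank_eq_one hker
    (x := ⟨w, hAw⟩) (fun h => hw (congrArg Subtype.val h)) ⟨v, hv⟩
  exact ⟨c, congrArg Subtype.val hc⟩

lemma exists_smul_eq_of_cx_camera_mulVec_eq_zero {A : Matrix (Fin 3) (Fin 4) ℝ}
    (hA : A.rank = 3) {w : Fin 4 → ℝ} (hw : w ≠ 0) (hAw : A.mulVec w = 0) {z : Fin 4 → ℂ}
    (hz : (cx A).mulVec z = 0) : ∃ c : ℂ, c • cxVec w = z := by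
  have h := hz
  rw [eq_cxVec_re_add_im z, Matrix.mulVec_add, Matrix.mulVec_smul, cx_mulVec_cxVec,
    cx_mulVec_cxVec] at h
  obtain ⟨h₁, h₂⟩ := cxVec_add_I_smul_eq_zero h
  obtain ⟨a, ha⟩ := exists_smul_eq_of_camera_mulVec_eq_zero hA hw hAw h₁
  obtain ⟨b, hb⟩ := exists_smul_eq_of_camera_mulVec_eq_zero hA hw hAw h₂
  refine ⟨a + Complex.I * b, ?_⟩
  rw [eq_cxVec_re_add_im z, ← ha, ← hb]
  ext k
  simp [cxVec]
  ring

lemma linearIndependent_of_not_collinear {V : Type*} [AddCommGroup V] [Module ℝ V]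
    {w : Fin 3 → V} (hw : ∀ i, w i ≠ 0)
    (hdist : ∀ i j : Fin 3, i ≠ j → ∀ l : ℝ, w j ≠ l • w i)
    (hline : ¬ ∃ W : Submodule ℝ V, Module.finrank ℝ W = 2 ∧ ∀ i, w i ∈ W) :
    LinearIndependent ℝ w := by
  have h01 : LinearIndependent ℝ ![w 0, w 1] :=
    (LinearIndependent.pair_iff' (hw 0)).2 fun a h => hdist 0 1 (by decide) a h.symm
  have h2 : w 2 ∉ Submodule.span ℝ (Set.range ![w 0, w 1]) := by
    intro h
    refine hline ⟨_, finrank_span_eq_card h01, fun i => ?_⟩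
    fin_cases i
    · exact Submodule.subset_span ⟨0, rfl⟩
    · exact Submodule.subset_span ⟨1, rfl⟩
    · exact h
  have h012 := linearIndependent_finSnoc.2 ⟨h01, h2⟩
  have hsnoc : (Fin.snoc ![w 0, w 1] (w 2) : Fin 3 → V) = w := by
    ext i
    fin_cases i <;> rfl
  exact hsnoc ▸ h012

theorem statement12
    (P Q : Fin 3 → Matrix (Fin 3) (Fin 4) ℝ)
    (hPrank : ∀ i, (P i).rank = 3) (hQrank : ∀ i, (Q i).rank = 3)
    (w : Fin 3 → Fin 4 → ℝ)
    (hw : ∀ i, w i ≠ 0) (hker : ∀ i, (Q i).mulVec (w i) = 0)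
    (hdist : ∀ i j : Fin 3, i ≠ j → ∀ l : ℝ, w j ≠ l • w i)
    (hline : ¬ ∃ W : Submodule ℝ (Fin 4 → ℝ),
        Module.finrank ℝ W = 2 ∧ ∀ i, w i ∈ W)
    (ξ : Fin 4 → ℂ) (hξ : ξ ≠ 0)
    (hnc : ∀ i, (cx (P i)).mulVec ξ ≠ 0)
    (L : Fin 3 → Submodule ℂ (Fin 4 → ℂ))
    (hL : ∀ i, L i = Submodule.comap ((cx (Q i)).mulVecLin)
        (Submodule.span ℂ {(cx (P i)).mulVec ξ})) :
    Module.finrank ℂ ↥(L 0 ⊔ L 1 ⊔ L 2) ≤ 3 ↔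
      ∀ i : Fin 3, (cx (P i)).mulVec ξ ∈
        Submodule.span ℂ {u : Fin 3 → ℂ | ∃ j : Fin 3, j ≠ i ∧
          u = (cx (Q i)).mulVec (fun k => (w j k : ℂ))} := by
  set W : Submodule ℂ (Fin 4 → ℂ) := Submodule.span ℂ (Set.range fun i => cxVec (w i)) with hW
  have hWrank : Module.finrank ℂ W = 3 := by
    simpa using finrank_span_eq_card
      (linearIndependent_cxVec (linearIndependent_of_not_collinear hw hdist hline))
  have hwW (i : Fin 3) : cxVec (w i) ∈ W := Submodule.subset_span ⟨i, rfl⟩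
  have hQw (i : Fin 3) : (cx (Q i)).mulVec (cxVec (w i)) = 0 := by
    rw [cx_mulVec_cxVec, hker]
    ext k
    simp [cxVec]
  have hle (i : Fin 3) : L i ≤ L 0 ⊔ L 1 ⊔ L 2 := by
    fin_cases i
    · exact le_sup_left.trans le_sup_left
    · exact le_sup_right.trans le_sup_left
    · exact le_sup_right
  constructor
  · intro h i
    have hWS : W ≤ L 0 ⊔ L 1 ⊔ L 2 := by
      rw [hW, Submodule.span_le]
      rintro _ ⟨j, rfl⟩
      refine hle j ?_
      rw [hL, Submodule.mem_comap, Matrix.mulVecLin_apply, hQw]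
      exact zero_mem _
    have hWeq : W = L 0 ⊔ L 1 ⊔ L 2 :=
      Submodule.eq_of_le_of_finrank_le hWS (h.trans hWrank.ge)
    obtain ⟨v, hv⟩ :=
      cx_mulVec_surjective (camera_mulVec_surjective (hQrank i)) ((cx (P i)).mulVec ξ)
    have hvW : v ∈ W := by
      rw [hWeq]
      refine hle i ?_
      rw [hL, Submodule.mem_comap, Matrix.mulVecLin_apply, hv]
      exact Submodule.mem_span_singleton_self _
    rw [← hv]
    suffices hWle : W ≤ Submodule.comap (cx (Q i)).mulVecLin
        (Submodule.span ℂ {u : Fin 3 → ℂ | ∃ j : Fin 3, j ≠ i ∧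
          u = (cx (Q i)).mulVec (fun k => (w j k : ℂ))}) from hWle hvW
    rw [hW, Submodule.span_le]
    rintro _ ⟨j, rfl⟩
    by_cases hji : j = i
    · subst hji
      simp [hQw]
    · exact Submodule.subset_span ⟨j, hji, rfl⟩
  · intro h
    have hLW (i : Fin 3) : L i ≤ W := by
      have hmap : Submodule.span ℂ {u : Fin 3 → ℂ | ∃ j : Fin 3, j ≠ i ∧
          u = (cx (Q i)).mulVec (fun k => (w j k : ℂ))} ≤ W.map (cx (Q i)).mulVecLin := by
        rw [Submodule.span_le]
        rintro _ ⟨j, -, rfl⟩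
        exact ⟨_, hwW j, rfl⟩
      obtain ⟨v, hvW, hv⟩ := hmap (h i)
      intro z hz
      rw [hL, Submodule.mem_comap, Submodule.mem_span_singleton] at hz
      obtain ⟨c, hc⟩ := hz
      have h0 : (cx (Q i)).mulVec (z - c • v) = 0 := by
        change (cx (Q i)).mulVecLin (z - c • v) = 0
        rw [map_sub, map_smul, hv, hc, sub_self]
      obtain ⟨d, hd⟩ :=
        exists_smul_eq_of_cx_camera_mulVec_eq_zero (hQrank i) (hw i) (hker i) h0
      rw [← sub_add_cancel z (c • v), ← hd]
      exact add_mem (W.smul_mem d (hwW i)) (W.smul_mem c hvW)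
    exact (Submodule.finrank_mono (sup_le (sup_le (hLW 0) (hLW 1)) (hLW 2))).trans hWrank.le
end
end

section
/- Let C ⊂ ℙ³ be a twisted cubic and let P₁,P₂,P₃ be cameras with pairwise distinct camera centers all lying on C. Then for every nonempty set X ⊆ C of points, none of which is a camera center, the configuration (P₁,P₂,P₃,X) is a critical configuration. -/
open Matrix

noncomputable section

/-- The parameter vector `[s³ : s²t : st² : t³]` of the standard twisted cubic. -/
def cubicVec (s t : ℂ) : Fin 4 → ℂ := ![s ^ 3, s ^ 2 * t, s * t ^ 2, t ^ 3]

/-- The twisted cubic `H · {[s³ : s²t : st² : t³]}` determined by `H ∈ GL₄(ℝ)`. -/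
def TwistedCubic (H : Matrix (Fin 4) (Fin 4) ℝ) : Set P3 :=
  {z | ∃ s t : ℂ, ¬(s = 0 ∧ t = 0) ∧
    z.rep ∈ Submodule.span ℂ {(cx H).mulVec (cubicVec s t)}}

/-- The matrix of multiplication by the linear form `α s + β t`, from binary quadratic monomials
to binary cubic monomials. -/
def linFormMul (α β : ℝ) : Matrix (Fin 3) (Fin 4) ℝ :=
  !![α, β, 0, 0; 0, α, β, 0; 0, 0, α, β]

theorem cx_mul {l m n : Type*} [Fintype m] (A : Matrix l m ℝ) (B : Matrix m n ℝ) :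
    cx (A * B) = cx A * cx B := by
  ext i j
  simp [cx, Matrix.mul_apply]

theorem cx_one {n : Type*} [DecidableEq n] : cx (1 : Matrix n n ℝ) = 1 := by
  ext i j
  by_cases h : i = j <;> simp [cx, Matrix.one_apply, h]

theorem cx_mulVec_ofReal {m n : Type*} [Fintype n] (A : Matrix m n ℝ) (w : n → ℝ) :
    (cx A).mulVec (fun i => (w i : ℂ)) = fun i => ((A.mulVec w i : ℝ) : ℂ) := by
  ext i
  simp [cx, Matrix.mulVec, dotProduct]

theorem cx_mulVec_injective {n : Type*} [Fintype n] [DecidableEq n] {A : Matrix n n ℝ}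
    (hA : IsUnit A) : Function.Injective (cx A).mulVec := by
  obtain ⟨B, hB⟩ := hA.exists_left_inv
  intro x y h
  have h' := congrArg (cx B).mulVec h
  simpa [Matrix.mulVec_mulVec, ← cx_mul, hB, cx_one] using h'

theorem linFormMul_mulVec_cubicVec (α β : ℝ) (s t : ℂ) :
    (cx (linFormMul α β)).mulVec (cubicVec s t) =
      ((α : ℂ) * s + β * t) • ![s ^ 2, s * t, t ^ 2] := by
  ext i
  fin_cases i <;>
    simp [cx, linFormMul, cubicVec, Matrix.mulVec, dotProduct, Fin.sum_univ_four] <;> ring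

/-- The complex kernel of a camera is a line. -/
theorem exists_smul_of_mulVec_eq_zero {P : Matrix (Fin 3) (Fin 4) ℝ} (hP : P.rank = 3)
    {x y : Fin 4 → ℂ} (hx : (cx P).mulVec x = 0) (hy : (cx P).mulVec y = 0) (hx0 : x ≠ 0) :
    ∃ k : ℂ, k • x = y := by
  have hsurj : Function.Surjective P.mulVec := by
    have : LinearMap.range P.mulVecLin = ⊤ := by
      apply Submodule.eq_top_of_finrank_eq
      rw [← Matrix.rank, hP]
      simp
    exact LinearMap.range_eq_top.1 this
  obtain ⟨B, hB⟩ := Matrix.mulVec_surjective_iff_exists_right_inverse.1 hsurj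
  have hsurj' : Function.Surjective (cx P).mulVec :=
    Matrix.mulVec_surjective_iff_exists_right_inverse.2 ⟨cx B, by rw [← cx_mul, hB, cx_one]⟩
  have hrange : LinearMap.range (cx P).mulVecLin = ⊤ := LinearMap.range_eq_top.2 hsurj'
  have hker : Module.finrank ℂ (LinearMap.ker (cx P).mulVecLin) = 1 := by
    have := LinearMap.finrank_range_add_finrank_ker (cx P).mulVecLin
    rw [hrange, finrank_top] at this
    simp at this
    omega
  obtain ⟨k, hk⟩ := (finrank_eq_one_iff_of_nonzero'
    (⟨x, hx⟩ : LinearMap.ker (cx P).mulVecLin) (by simpa [Subtype.ext_iff] using hx0)).1 hker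
      ⟨y, hy⟩
  exact ⟨k, congrArg Subtype.val hk⟩

theorem IsCenter.eq {P : Matrix (Fin 3) (Fin 4) ℝ} (hP : P.rank = 3) {x y : P3}
    (hx : IsCenter P x) (hy : IsCenter P y) : x = y := by
  obtain ⟨k, hk⟩ := exists_smul_of_mulVec_eq_zero hP hy hx y.rep_nonzero
  rw [← x.mk_rep, ← y.mk_rep]
  exact (Projectivization.mk_eq_mk_iff' ℂ _ _ x.rep_nonzero y.rep_nonzero).2 ⟨k, hk⟩

/-- A real camera with a complex point of the standard twisted cubic in its kernel has a real one. -/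
theorem exists_real_cubic_kernel {M : Matrix (Fin 3) (Fin 4) ℝ} (hM : M.rank = 3) {s t : ℂ}
    (hst : ¬(s = 0 ∧ t = 0)) (h : (cx M).mulVec (cubicVec s t) = 0) :
    ∃ u v : ℝ, ¬(u = 0 ∧ v = 0) ∧ M.mulVec ![u ^ 3, u ^ 2 * v, u * v ^ 2, v ^ 3] = 0 := by
  suffices ∃ u v : ℝ, ¬(u = 0 ∧ v = 0) ∧ ∃ k : ℂ, cubicVec u v = k • cubicVec s t by
    obtain ⟨u, v, huv, k, hk⟩ := this
    refine ⟨u, v, huv, ?_⟩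
    have h1 : (cx M).mulVec (cubicVec u v) = 0 := by
      rw [hk, Matrix.mulVec_smul, h, smul_zero]
    have h2 : cubicVec u v =
        fun i => ((![u ^ 3, u ^ 2 * v, u * v ^ 2, v ^ 3] i : ℝ) : ℂ) := by
      ext i
      fin_cases i <;> simp [cubicVec]
    rw [h2, cx_mulVec_ofReal] at h1
    ext i
    simpa using congrFun h1 i
  obtain ⟨w, hw, hw0⟩ := Submodule.exists_mem_ne_zero_of_ne_bot
    (LinearMap.ker_ne_bot_of_finrank_lt (f := M.mulVecLin) (by simp))
  have hw' : M.mulVec w = 0 := hw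
  have hcw : (cx M).mulVec (fun i => (w i : ℂ)) = 0 := by
    rw [cx_mulVec_ofReal, hw']
    ext i
    simp
  obtain ⟨k, hk⟩ := exists_smul_of_mulVec_eq_zero hM hcw h fun h0 => hw0 <| by
    ext i
    simpa using congrFun h0 i
  have e0 : k * w 0 = s ^ 3 := by simpa [cubicVec] using congrFun hk 0
  have e1 : k * w 1 = s ^ 2 * t := by simpa [cubicVec] using congrFun hk 1
  by_cases hs : s = 0
  · have ht : t ≠ 0 := fun ht => hst ⟨hs, ht⟩
    refine ⟨0, 1, by simp, (t ^ 3)⁻¹, ?_⟩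
    ext i
    fin_cases i <;> simp [cubicVec, hs, ht]
  · have hk0 : k ≠ 0 := by
      rintro rfl
      exact hs (by simpa using e0.symm)
    have hw00 : w 0 ≠ 0 := by
      intro h0
      exact hs (by simpa [h0] using e0.symm)
    have hr : (w 1 : ℂ) = w 0 / s * t := by
      have : k * s ^ 3 * (w 1 * s - w 0 * t) = 0 := by
        linear_combination s ^ 4 * e1 - s ^ 3 * t * e0
      have := (mul_eq_zero.1 this).resolve_left (by simp [hk0, hs])
      field_simp
      linear_combination this
    refine ⟨w 0, w 1, by simp [hw00], (w 0 / s) ^ 3, ?_⟩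
    ext i
    fin_cases i <;> simp [cubicVec, hr] <;> field_simp

theorem exists_linForm_factor (u v : ℝ) (huv : ¬(u = 0 ∧ v = 0)) (m : Fin 4 → ℝ)
    (h : m ⬝ᵥ ![u ^ 3, u ^ 2 * v, u * v ^ 2, v ^ 3] = 0) :
    ∃ x : Fin 3 → ℝ, x ᵥ* linFormMul v (-u) = m := by
  simp [dotProduct, Fin.sum_univ_four] at h
  by_cases hv : v = 0
  · have hu : u ≠ 0 := fun hu => huv ⟨hu, hv⟩
    simp [hv, hu] at h
    refine ⟨![-m 1 / u, -m 2 / u, -m 3 / u], ?_⟩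
    ext i
    fin_cases i <;>
      simp [linFormMul, Matrix.vecMul, dotProduct, Fin.sum_univ_three, hv, h] <;> field_simp
  · refine ⟨![m 0 / v, (m 1 + u * (m 0 / v)) / v, (m 2 + u * ((m 1 + u * (m 0 / v)) / v)) / v], ?_⟩
    ext i
    fin_cases i <;>
      simp [linFormMul, Matrix.vecMul, dotProduct, Fin.sum_univ_three] <;> field_simp <;>
      linarith

/-- A camera whose center lies on a twisted cubic restricts to the cubic as a linear form times
a quadratic parametrization of a conic. -/
theorem exists_camera_factorization {H : Matrix (Fin 4) (Fin 4) ℝ} (hH : IsUnit H)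
    {P : Matrix (Fin 3) (Fin 4) ℝ} (hP : P.rank = 3) {c : P3} (hc : IsCenter P c)
    (hcC : c ∈ TwistedCubic H) :
    ∃ (A : Matrix (Fin 3) (Fin 3) ℝ) (α β : ℝ),
      IsUnit A ∧ ¬(α = 0 ∧ β = 0) ∧ P * H = A * linFormMul α β := by
  have hdet := (Matrix.isUnit_iff_isUnit_det H).1 hH
  have hM : (P * H).rank = 3 := by rw [Matrix.rank_mul_eq_left_of_isUnit_det _ _ hdet, hP]
  obtain ⟨s, t, hst, hmem⟩ := hcC
  obtain ⟨k, hk⟩ := Submodule.mem_span_singleton.1 hmem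
  have hk0 : k ≠ 0 := by
    rintro rfl
    exact c.rep_nonzero (by simpa using hk.symm)
  have hker : (cx (P * H)).mulVec (cubicVec s t) = 0 := by
    have h : (cx P).mulVec c.rep = 0 := hc
    rw [← hk, Matrix.mulVec_smul, Matrix.mulVec_mulVec, ← cx_mul] at h
    exact (smul_eq_zero.1 h).resolve_left hk0
  obtain ⟨u, v, huv, hreal⟩ := exists_real_cubic_kernel hM hst hker
  choose A hA using fun i => exists_linForm_factor u v huv ((P * H) i) (congrFun hreal i)
  have hfac : P * H = Matrix.of A * linFormMul v (-u) := by
    ext i j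
    exact (congrFun (hA i) j).symm
  refine ⟨Matrix.of A, v, -u, ?_, fun h => huv ⟨neg_eq_zero.1 h.2, h.1⟩, hfac⟩
  have hle := Matrix.rank_mul_le_left (Matrix.of A) (linFormMul v (-u))
  rw [← hfac, hM] at hle
  have hrange : LinearMap.range (Matrix.of A).mulVecLin = ⊤ := by
    apply Submodule.eq_top_of_finrank_eq
    rw [← Matrix.rank]
    refine le_antisymm ?_ (by simpa using hle)
    simpa using Matrix.rank_le_height (Matrix.of A)
  exact Matrix.mulVec_surjective_iff_isUnit.1 (LinearMap.range_eq_top.1 hrange)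

/-- No linear change of coordinates exchanges, up to scale, multiplication by two independent
linear forms. -/
theorem linFormMul_not_swapped {α β γ δ l l' : ℝ} {G : Matrix (Fin 4) (Fin 4) ℝ}
    (hΔ : α * δ - β * γ ≠ 0) (hl : l ≠ 0) (hl' : l' ≠ 0)
    (h : linFormMul α β * G = l • linFormMul γ δ)
    (h' : linFormMul γ δ * G = l' • linFormMul α β) : False := by
  have e00 := congrFun (congrFun h 0) 0
  have e10 := congrFun (congrFun h 1) 0
  have e01 := congrFun (congrFun h 0) 1
  have e11 := congrFun (congrFun h 1) 1
  have f00 := congrFun (congrFun h' 0) 0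
  have f10 := congrFun (congrFun h' 1) 0
  have f01 := congrFun (congrFun h' 0) 1
  have f11 := congrFun (congrFun h' 1) 1
  simp [linFormMul, Matrix.mul_apply, Fin.sum_univ_four] at e00 e10 e01 e11 f00 f10 f01 f11
  have k1 : l' * α ^ 2 = l * γ ^ 2 := by
    linear_combination γ * e00 - α * f00 + δ * e10 - β * f10
  have k2 : l * γ * δ = l' * α * β := by
    have : 2 * (l * γ * δ - l' * α * β) = 0 := by
      linear_combination α * f01 - γ * e01 - (δ * e11 - β * f11)
    linarith
  have hα : α = 0 := by
    have : l' * (α * (α * δ - β * γ)) = 0 := by linear_combination δ * k1 + γ * k2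
    simpa [hl', hΔ] using this
  have hγ : γ = 0 := by
    simpa [hα, hl] using k1
  simp [hα, hγ] at hΔ

theorem statement15
    (H : Matrix (Fin 4) (Fin 4) ℝ) (hH : IsUnit H)
    (P : Fin 3 → Matrix (Fin 3) (Fin 4) ℝ) (hrank : ∀ i, (P i).rank = 3)
    (c : Fin 3 → P3) (hc : ∀ i, IsCenter (P i) (c i))
    (hdist : ∀ i j : Fin 3, i ≠ j → c i ≠ c j)
    (hcC : ∀ i, c i ∈ TwistedCubic H)
    (X : Set P3) (hXC : X ⊆ TwistedCubic H) (hne : X.Nonempty)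
    (hXc : ∀ x ∈ X, ∀ i, ¬ IsCenter (P i) x) :
    IsCritical 3 P X := by
  choose A α β hA hαβ hfac using
    fun i => exists_camera_factorization hH (hrank i) (hc i) (hcC i)
  have hPfac : ∀ i, P i = A i * linFormMul (α i) (β i) * H⁻¹ := fun i => by
    rw [← hfac, Matrix.mul_nonsing_inv_cancel_right _ _ ((Matrix.isUnit_iff_isUnit_det H).1 hH)]
  have hsep : ∀ i j, i ≠ j → ∀ z, IsCenter (P i) z → ¬ IsCenter (P j) z := fun i j hij z hi hj =>
    hdist i j hij (((hc i).eq (hrank i) hi).trans (hj.eq (hrank j) (hc j)))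
  set σ : Equiv.Perm (Fin 3) := Equiv.swap 0 1 with hσ
  have hA' : ∀ i, (A i)⁻¹ * A i = 1 := fun i =>
    Matrix.nonsing_inv_mul _ ((Matrix.isUnit_iff_isUnit_det _).1 (hA i))
  have hunit : ∀ i, IsUnit (A i * (A (σ i))⁻¹) := fun i =>
    (hA i).mul (Matrix.isUnit_nonsing_inv_iff.2 (hA (σ i)))
  have hQfac : ∀ i, A i * (A (σ i))⁻¹ * P (σ i) =
      A i * linFormMul (α (σ i)) (β (σ i)) * H⁻¹ := fun i => by
    rw [hPfac (σ i)]
    simp only [Matrix.mul_assoc]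
    rw [← Matrix.mul_assoc _ (A (σ i)), hA', Matrix.one_mul]
  have hcenter : ∀ i z, IsCenter (A i * (A (σ i))⁻¹ * P (σ i)) z → IsCenter (P (σ i)) z := by
    intro i z hz
    apply cx_mulVec_injective (hunit i)
    rw [Matrix.mulVec_mulVec, ← cx_mul, Matrix.mulVec_zero]
    exact hz
  have hsame : ∀ x ∈ X, ∀ i, SameImage (P i) (A i * (A (σ i))⁻¹ * P (σ i)) x x := by
    intro x hx i
    obtain ⟨s, t, -, hmem⟩ := hXC hx
    obtain ⟨k, hk⟩ := Submodule.mem_span_singleton.1 hmem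
    have himage : ∀ (B : Matrix (Fin 3) (Fin 3) ℝ) (a b : ℝ),
        (cx (B * linFormMul a b * H⁻¹)).mulVec x.rep =
          ((a : ℂ) * s + b * t) • k • (cx B).mulVec ![s ^ 2, s * t, t ^ 2] := by
      intro B a b
      rw [← hk, Matrix.mulVec_smul, Matrix.mulVec_mulVec, ← cx_mul,
        Matrix.nonsing_inv_mul_cancel_right _ _ ((Matrix.isUnit_iff_isUnit_det H).1 hH), cx_mul,
        ← Matrix.mulVec_mulVec, linFormMul_mulVec_cubicVec, Matrix.mulVec_smul, smul_comm]
    have hform : ∀ j, (α j : ℂ) * s + β j * t ≠ 0 := fun j h0 => hXc x hx j <| by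
      rw [IsCenter, hPfac, himage, h0, zero_smul]
    refine ⟨((α i : ℂ) * s + β i * t) / (α (σ i) * s + β (σ i) * t),
      div_ne_zero (hform _) (hform _), ?_⟩
    rw [hQfac, hPfac, himage, himage, smul_smul (_ / _), div_mul_cancel₀ _ (hform _)]
  refine ⟨fun i => A i * (A (σ i))⁻¹ * P (σ i), X, ⟨fun i => ?_, ?_, ?_⟩,
    fun x hx => ⟨x, hx, hsame x hx⟩, fun x hx => ⟨x, hx, hsame x hx⟩, ?_⟩
  · rw [Matrix.rank_mul_eq_right_of_isUnit_det _ _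
      ((Matrix.isUnit_iff_isUnit_det _).1 (hunit i)), hrank]
  · exact fun i j hij z hi hj =>
      hsep _ _ (σ.injective.ne hij) z (hcenter i z hi) (hcenter j z hj)
  · exact fun x hx i h => hXc x hx _ (hcenter i x h)
  rintro ⟨K, -, -, -, hK⟩
  have hswap : ∀ i, ∃ l : ℝ, l ≠ 0 ∧ linFormMul (α i) (β i) * (H⁻¹ * K⁻¹ * H) =
      l • linFormMul (α (σ i)) (β (σ i)) := by
    intro i
    obtain ⟨l, hl, h⟩ := hK i
    refine ⟨l, hl, ?_⟩
    beta_reduce at h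
    rw [hQfac, hPfac] at h
    have h' := congrArg (fun M => (A i)⁻¹ * M * H) h
    simp only [Matrix.mul_assoc, Matrix.mul_smul, Matrix.smul_mul] at h'
    simpa only [← Matrix.mul_assoc, hA', Matrix.one_mul,
      Matrix.nonsing_inv_mul_cancel_right _ _ ((Matrix.isUnit_iff_isUnit_det H).1 hH)] using h'
  obtain ⟨l, hl, h⟩ := hswap 0
  obtain ⟨l', hl', h'⟩ := hswap 1
  rw [hσ, Equiv.swap_apply_left] at h
  rw [hσ, Equiv.swap_apply_right] at h'
  refine linFormMul_not_swapped (fun hΔ => ?_) hl hl' h h'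
  obtain ⟨r, hr⟩ : ∃ r : ℝ, linFormMul (α 1) (β 1) = r • linFormMul (α 0) (β 0) := by
    by_cases hα : α 0 = 0
    · have hβ : β 0 ≠ 0 := fun hβ => hαβ 0 ⟨hα, hβ⟩
      have hα1 : α 1 = 0 := by simpa [hα, hβ] using hΔ
      refine ⟨β 1 / β 0, ?_⟩
      ext i j
      fin_cases i <;> fin_cases j <;> simp [linFormMul, hα, hα1, hβ]
    · have hβ1 : β 1 = α 1 / α 0 * β 0 := by
        field_simp
        linarith
      refine ⟨α 1 / α 0, ?_⟩
      ext i j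
      fin_cases i <;> fin_cases j <;> simp [linFormMul, hα, hβ1]
  have hP1 : P 1 = (r • (A 1 * (A 0)⁻¹)) * P 0 := by
    rw [hPfac 1, hPfac 0, hr]
    simp only [Matrix.mul_assoc, Matrix.mul_smul, Matrix.smul_mul]
    rw [← Matrix.mul_assoc _ (A 0), hA', Matrix.one_mul]
  refine hsep 0 1 (by decide) (c 0) (hc 0) ?_
  have h0 : (cx (P 0)).mulVec (c 0).rep = 0 := hc 0
  rw [IsCenter, hP1, cx_mul, ← Matrix.mulVec_mulVec, h0, Matrix.mulVec_zero]
end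
end
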